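/- Let $P_1,\dots,P_m$ be complex polynomials with $\deg P_j = k_j$, where $0\leq k_1 < \cdots < k_m \leq 2m-1$, and let $z=\exp(i\pi/m)$. Define $\Delta(\zeta) = \det\big[P_j(i z^{\ell-1}\zeta)\big]_{\ell,j=1}^m$. Then $\Delta$ is a polynomial in $\zeta$ of degree exactly $\varkappa = \sum_{j=1}^m k_j$. -/

import Mathlib

open Complex Polynomial

theorem coeff_prod_sum_of_natDegree_le {R ι : Type*} [CommSemiring R] (s : Finset ι)
    (f : ι → R[X]) (d : ι → ℕ) (h : ∀ i ∈ s, (f i).natDegree ≤ d i) :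
    (∏ i ∈ s, f i).coeff (∑ i ∈ s, d i) = ∏ i ∈ s, (f i).coeff (d i) := by
  classical
  induction s using Finset.induction_on with
  | empty => simp
  | insert a s ha ih =>
    have hs : ∀ i ∈ s, (f i).natDegree ≤ d i := fun i hi => h i (Finset.mem_insert_of_mem hi)
    rw [Finset.prod_insert ha, Finset.sum_insert ha, Finset.prod_insert ha, ← ih hs]
    exact coeff_mul_add_eq_of_natDegree_le (h a (Finset.mem_insert_self a s))
      ((natDegree_prod_le s f).trans (Finset.sum_le_sum hs))

theorem natDegree_det_le_sum_of_natDegree_le {R n : Type*} [CommRing R] [Fintype n]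
    [DecidableEq n] (M : Matrix n n R[X]) (d : n → ℕ) (h : ∀ i j, (M i j).natDegree ≤ d j) :
    M.det.natDegree ≤ ∑ j, d j := by
  rw [Matrix.det_apply]
  refine natDegree_sum_le_of_forall_le _ _ fun σ _ => ?_
  exact (natDegree_smul_le _ _).trans
    ((natDegree_prod_le _ _).trans (Finset.sum_le_sum fun j _ => h _ j))

theorem coeff_det_sum_of_natDegree_le {R n : Type*} [CommRing R] [Fintype n]
    [DecidableEq n] (M : Matrix n n R[X]) (d : n → ℕ) (h : ∀ i j, (M i j).natDegree ≤ d j) :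
    M.det.coeff (∑ j, d j) = (Matrix.of fun i j => (M i j).coeff (d j)).det := by
  rw [Matrix.det_apply, Matrix.det_apply, finsetSum_coeff]
  refine Finset.sum_congr rfl fun σ _ => ?_
  rw [coeff_smul, coeff_prod_sum_of_natDegree_le _ _ _ fun j _ => h _ j]
  rfl

theorem det_pow_ne_zero_of_isPrimitiveRoot {R : Type*} [CommRing R] [IsDomain R] {m n : ℕ}
    {z : R} (hz : IsPrimitiveRoot z n) {k : Fin m → ℕ} (hk : Function.Injective k)
    (hlt : ∀ j, k j < n) :
    (Matrix.of fun ℓ j : Fin m => (z ^ (ℓ : ℕ)) ^ k j).det ≠ 0 := by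
  have hV : (Matrix.of fun ℓ j : Fin m => (z ^ (ℓ : ℕ)) ^ k j) =
      (Matrix.vandermonde fun j => z ^ k j).transpose := by
    ext ℓ j
    simp [Matrix.vandermonde_apply, pow_right_comm]
  rw [hV, Matrix.det_transpose, Matrix.det_vandermonde_ne_zero_iff]
  exact fun i j hij => hk (hz.pow_inj (hlt i) (hlt j) hij)

theorem stmt_2 (m : ℕ) (hm : 1 ≤ m) (k : Fin m → ℕ)
    (hmono : StrictMono k) (hk : ∀ j, k j ≤ 2 * m - 1)
    (z : ℂ) (hz : z = Complex.exp (Real.pi * Complex.I / m))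
    (P : Fin m → Polynomial ℂ) (hP : ∀ j, (P j).natDegree = k j) (hP0 : ∀ j, P j ≠ 0)
    (Δ : ℂ → ℂ)
    (hΔ : ∀ ζ : ℂ, Δ ζ =
      (Matrix.of (fun ℓ j : Fin m => (P j).eval (Complex.I * z ^ (ℓ : ℕ) * ζ))).det) :
    ∃ Q : Polynomial ℂ, (∀ ζ, Q.eval ζ = Δ ζ) ∧ Q.degree = (∑ j, k j : ℕ) := by
  have hm0 : (m : ℂ) ≠ 0 := by exact_mod_cast (by omega : m ≠ 0)
  have hprim : IsPrimitiveRoot z (2 * m) := by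
    have h := Complex.isPrimitiveRoot_exp (2 * m) (by omega)
    convert h using 1
    rw [hz]
    congr 1
    push_cast
    field_simp
  let M : Matrix (Fin m) (Fin m) ℂ[X] :=
    Matrix.of fun ℓ j => (P j).comp (C (I * z ^ (ℓ : ℕ)) * X)
  have hM : ∀ ℓ j, (M ℓ j).natDegree ≤ k j := fun ℓ j => by
    refine natDegree_comp_le.trans ?_
    rw [hP]
    exact (Nat.mul_le_mul_left _ ((natDegree_C_mul_le _ _).trans natDegree_X_le)).trans
      (mul_one _).le
  refine ⟨M.det, fun ζ => ?_, ?_⟩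
  · rw [hΔ, ← coe_evalRingHom, RingHom.map_det]
    congr 1
    ext ℓ j
    simp [M]
  · have hcoeff : M.det.coeff (∑ j, k j) ≠ 0 := by
      have hentry : (Matrix.of fun ℓ j => (M ℓ j).coeff (k j)) =
          Matrix.of fun ℓ j => ((P j).leadingCoeff * I ^ k j) *
            (Matrix.of fun ℓ j : Fin m => (z ^ (ℓ : ℕ)) ^ k j) ℓ j := by
        ext ℓ j
        simp only [M, Matrix.of_apply, comp_C_mul_X_coeff, leadingCoeff, hP, mul_pow, mul_assoc]
      rw [coeff_det_sum_of_natDegree_le M k hM, hentry, Matrix.det_mul_row]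
      refine mul_ne_zero (Finset.prod_ne_zero_iff.mpr fun j _ => ?_)
        (det_pow_ne_zero_of_isPrimitiveRoot hprim hmono.injective fun j => ?_)
      · exact mul_ne_zero (leadingCoeff_ne_zero.mpr (hP0 j)) (pow_ne_zero _ I_ne_zero)
      · have := hk j
        omega
    exact le_antisymm (natDegree_le_iff_degree_le.mp (natDegree_det_le_sum_of_natDegree_le M k hM))
      (le_degree_of_ne_zero hcoeff)
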